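/- (Conformal invariance of the conformally coupled scalar Lagrangian.) Let g be a smooth metric on an open set U ⊆ ℝ⁴, let φ : U → ℝ be smooth, and let Ω : U → ℝ be smooth and everywhere positive. Set g'_{αβ} = Ω² g_{αβ} and φ' = Ω⁻¹ φ. Then at every point of U, √|det g'| ( g'^{αβ} ∂_αφ' ∂_βφ' + (R'/6) φ'² ) = √|det g| ( g^{αβ} ∂_αφ ∂_βφ + (R/6) φ² ) − ∂_μ( √|det g| · g^{μν} φ² ∂_ν(ln Ω) ); that is, the Lagrangian density with non-minimal coupling ξ = 1/6 is conformally invariant up to a total divergence. -/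

import Mathlib

open Matrix

/-- The partial derivative of `f : ℝ⁴ → ℝ` in the `μ`-th coordinate direction. -/
noncomputable def pd (μ : Fin 4) (f : (Fin 4 → ℝ) → ℝ) (x : Fin 4 → ℝ) : ℝ :=
  fderiv ℝ f x (Pi.single μ 1)

/-- The Levi-Civita connection `Λ^η_{αβ}` of a metric `g`. -/
noncomputable def levi (g : (Fin 4 → ℝ) → Matrix (Fin 4) (Fin 4) ℝ)
    (x : Fin 4 → ℝ) (η α β : Fin 4) : ℝ :=
  (1 / 2) * ∑ μ, (g x)⁻¹ η μ *
    (pd β (fun y => g y α μ) x + pd α (fun y => g y μ β) x - pd μ (fun y => g y α β) x)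

/-- The Riemann curvature tensor `R^a{}_{jki}` of the Levi-Civita connection of `g`. -/
noncomputable def riem (g : (Fin 4 → ℝ) → Matrix (Fin 4) (Fin 4) ℝ)
    (x : Fin 4 → ℝ) (a j k i : Fin 4) : ℝ :=
  pd k (fun y => levi g y a j i) x - pd i (fun y => levi g y a j k) x
    + ∑ r, (levi g x a r k * levi g x r j i - levi g x a r i * levi g x r j k)

/-- The Ricci tensor `R_{ji} = R^a{}_{jai}` of `g`. -/
noncomputable def ricci (g : (Fin 4 → ℝ) → Matrix (Fin 4) (Fin 4) ℝ)
    (x : Fin 4 → ℝ) (j i : Fin 4) : ℝ :=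
  ∑ a, riem g x a j a i

/-- The scalar curvature `R = g^{ji} R_{ji}` of `g`. -/
noncomputable def scal (g : (Fin 4 → ℝ) → Matrix (Fin 4) (Fin 4) ℝ)
    (x : Fin 4 → ℝ) : ℝ :=
  ∑ j, ∑ i, (g x)⁻¹ j i * ricci g x j i

/-- The Lagrangian density `√|det g| (g^{αβ} ∂_αφ ∂_βφ + (R/6) φ²)` of a conformally
coupled scalar field. -/
noncomputable def scalarLagrangian (g : (Fin 4 → ℝ) → Matrix (Fin 4) (Fin 4) ℝ)
    (φ : (Fin 4 → ℝ) → ℝ) (x : Fin 4 → ℝ) : ℝ :=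
  Real.sqrt |(g x).det| *
    ((∑ α, ∑ β, (g x)⁻¹ α β * pd α φ x * pd β φ x) + scal g x / 6 * (φ x) ^ 2)

theorem jacobi_pd (g : (Fin 4 → ℝ) → Matrix (Fin 4) (Fin 4) ℝ) (x : Fin 4 → ℝ)
    (hg : ∀ i j, DifferentiableAt ℝ (fun y => g y i j) x) (μ : Fin 4) :
    pd μ (fun y => (g y).det) x
      = ∑ i, ∑ j, pd μ (fun y => g y i j) x * (g x).adjugate j i := by
  have h1 : ∀ (M : Matrix (Fin 4) (Fin 4) ℝ) (i : Fin 4) (v : Fin 4 → ℝ),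
      ∑ j, v j * M.adjugate j i = (M.updateRow i v).det := by
    intro M i v
    rw [Matrix.det_eq_sum_mul_adjugate_row _ i]
    refine Finset.sum_congr rfl fun j _ => ?_
    rw [Matrix.adjugate_apply, Matrix.adjugate_apply]
    simp
  simp only [h1]
  have h2 : HasFDerivAt (fun y => (g y).det)
      (∑ σ : Equiv.Perm (Fin 4), ((Equiv.Perm.sign σ : ℤ) : ℝ) •
        ∑ i, (∏ j ∈ Finset.univ.erase i, g x (σ j) j) • fderiv ℝ (fun y => g y (σ i) i) x) x := by
    simp only [Matrix.det_apply']
    refine HasFDerivAt.fun_sum fun σ _ => ?_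
    refine HasFDerivAt.const_mul ?_ _
    exact HasFDerivAt.finsetProd fun i _ => (hg (σ i) i).hasFDerivAt
  unfold pd
  rw [h2.fderiv]
  simp only [Matrix.det_apply', _root_.sum_apply, _root_.smul_apply,
    smul_eq_mul]
  rw [Finset.sum_comm]
  refine Finset.sum_congr rfl fun σ _ => ?_
  rw [← Finset.mul_sum]
  congr 1
  symm
  rw [← Equiv.sum_comp σ]
  refine Finset.sum_congr rfl fun i _ => ?_
  rw [← Finset.mul_prod_erase _ _ (Finset.mem_univ i), mul_comm]
  congr 1
  · refine Finset.prod_congr rfl fun j hj => ?_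
    rw [Matrix.updateRow_ne]
    exact fun h => (Finset.mem_erase.1 hj).1 (σ.injective h)
  · simp

theorem pd_sqrt_det (g : (Fin 4 → ℝ) → Matrix (Fin 4) (Fin 4) ℝ) (x : Fin 4 → ℝ)
    (hg : ∀ i j, DifferentiableAt ℝ (fun y => g y i j) x) (hx : IsUnit (g x).det) (μ : Fin 4) :
    DifferentiableAt ℝ (fun y => Real.sqrt |(g y).det|) x ∧ 
    pd μ (fun y => Real.sqrt |(g y).det|) x
      = Real.sqrt |(g x).det| * ((1 / 2) * ∑ i, ∑ j, pd μ (fun y => g y i j) x * (g x)⁻¹ j i) := by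
  have hne := hx.ne_zero
  have hd : DifferentiableAt ℝ (fun y => (g y).det) x := by
    simp only [Matrix.det_apply']
    fun_prop
  have h1 : HasFDerivAt (fun y => |(g y).det|) 
     ((SignType.sign (g x).det : ℝ) • fderiv ℝ (fun y => (g y).det) x) x := 
    hd.hasFDerivAt.abs hne
  have h2 := h1.sqrt (abs_ne_zero.2 hne)
  refine ⟨h2.differentiableAt, ?_⟩
  have hj := jacobi_pd g x hg μ
  have hadj : ∀ i j, (g x).adjugate i j = (g x).det * (g x)⁻¹ i j := by
    intro i j
    rw [Matrix.inv_def]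
    simp [hne]
  simp only [hadj] at hj
  unfold pd at *
  rw [h2.fderiv]
  simp only [_root_.smul_apply, smul_eq_mul, hj]
  have e : ∑ i, ∑ j, (fderiv ℝ (fun y => g y i j) x) (Pi.single μ 1) * ((g x).det * (g x)⁻¹ j i)
     = (g x).det * ∑ i, ∑ j, (fderiv ℝ (fun y => g y i j) x) (Pi.single μ 1) * ((g x)⁻¹ j i) := by
    simp only [Finset.mul_sum]
    exact Finset.sum_congr rfl fun _ _ => Finset.sum_congr rfl fun _ _ => by ring
  rw [e]
  have hs : 0 < √|(g x).det| := Real.sqrt_pos.2 (abs_pos.2 hne)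
  have hs2 : √|(g x).det| * √|(g x).det| = SignType.sign (g x).det * (g x).det := by
    rw [Real.mul_self_sqrt (abs_nonneg _), sign_mul_self]
  generalize √|(g x).det| = s at *
  field_simp
  rw [sq, hs2]
section helpers
variable {x : Fin 4 → ℝ} {f h : (Fin 4 → ℝ) → ℝ}

theorem pd_mul (k : Fin 4) (hf : DifferentiableAt ℝ f x) (hh : DifferentiableAt ℝ h x) :
    pd k (fun y => f y * h y) x = pd k f x * h x + f x * pd k h x := by
  unfold pd
  rw [fderiv_fun_mul hf hh]
  simp
  ring

theorem pd_add (k : Fin 4) (hf : DifferentiableAt ℝ f x) (hh : DifferentiableAt ℝ h x) :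
    pd k (fun y => f y + h y) x = pd k f x + pd k h x := by
  unfold pd
  rw [fderiv_fun_add hf hh]
  simp

theorem pd_sub (k : Fin 4) (hf : DifferentiableAt ℝ f x) (hh : DifferentiableAt ℝ h x) :
    pd k (fun y => f y - h y) x = pd k f x - pd k h x := by
  unfold pd
  rw [fderiv_fun_sub hf hh]
  simp

theorem pd_sum (k : Fin 4) (F : Fin 4 → (Fin 4 → ℝ) → ℝ)
    (hF : ∀ i, DifferentiableAt ℝ (F i) x) :
    pd k (fun y => ∑ i, F i y) x = ∑ i, pd k (F i) x := by
  unfold pd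
  rw [fderiv_fun_sum fun i _ => hF i]
  simp

theorem pd_ite (k : Fin 4) (p : Prop) [Decidable p] :
    pd k (fun y => if p then f y else 0) x = if p then pd k f x else 0 := by
  split_ifs <;> simp [pd]

theorem pd_congr_open {U : Set (Fin 4 → ℝ)} (hU : IsOpen U) (hx : x ∈ U) (k : Fin 4)
    (hfh : ∀ y ∈ U, f y = h y) : pd k f x = pd k h x := by
  unfold pd
  rw [Filter.EventuallyEq.fderiv_eq]
  filter_upwards [hU.mem_nhds hx] with y hy using hfh y hy

theorem pd_smooth {U : Set (Fin 4 → ℝ)} (hU : IsOpen U) (k : Fin 4)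
    (hf : ContDiffOn ℝ (⊤ : ℕ∞) f U) : ContDiffOn ℝ (⊤ : ℕ∞) (pd k f) U := by
  have := hf.fderiv_of_isOpen hU (m := ((⊤ : ℕ∞) : WithTop ℕ∞)) (by simp)
  exact this.clm_apply contDiffOn_const

theorem smooth_diff {U : Set (Fin 4 → ℝ)} (hU : IsOpen U) (hx : x ∈ U)
    (hf : ContDiffOn ℝ (⊤ : ℕ∞) f U) : DifferentiableAt ℝ f x :=
  (hf.contDiffAt (hU.mem_nhds hx)).differentiableAt (by simp)

theorem det_smooth {U : Set (Fin 4 → ℝ)} (g : (Fin 4 → ℝ) → Matrix (Fin 4) (Fin 4) ℝ)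
    (hg : ∀ μ ν : Fin 4, ContDiffOn ℝ (⊤ : ℕ∞) (fun x => g x μ ν) U) :
    ContDiffOn ℝ (⊤ : ℕ∞) (fun y => (g y).det) U := by
  simp only [Matrix.det_apply']
  exact ContDiffOn.sum fun σ _ => contDiffOn_const.mul (contDiffOn_prod fun i _ => hg _ _)

theorem inv_smooth {U : Set (Fin 4 → ℝ)} (g : (Fin 4 → ℝ) → Matrix (Fin 4) (Fin 4) ℝ)
    (hg : ∀ μ ν : Fin 4, ContDiffOn ℝ (⊤ : ℕ∞) (fun x => g x μ ν) U)
    (hginv : ∀ x ∈ U, IsUnit (g x).det) (i j : Fin 4) :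
    ContDiffOn ℝ (⊤ : ℕ∞) (fun y => (g y)⁻¹ i j) U := by
  have : (fun y => (g y)⁻¹ i j)
      = fun y => (g y).det⁻¹ * ((g y).updateRow j (Pi.single i 1)).det := by
    funext y
    rw [Matrix.inv_def, Matrix.smul_apply, Matrix.adjugate_apply]
    simp
  rw [this]
  refine ((det_smooth g hg).inv fun y hy => (hginv y hy).ne_zero).mul (det_smooth _ ?_)
  intro a b
  by_cases h : a = j
  · subst h
    simp only [Matrix.updateRow_self]
    exact contDiffOn_const
  · simp only [Matrix.updateRow_ne h]
    exact hg a b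

theorem levi_smooth {U : Set (Fin 4 → ℝ)} (hU : IsOpen U)
    (g : (Fin 4 → ℝ) → Matrix (Fin 4) (Fin 4) ℝ)
    (hg : ∀ μ ν : Fin 4, ContDiffOn ℝ (⊤ : ℕ∞) (fun x => g x μ ν) U)
    (hginv : ∀ x ∈ U, IsUnit (g x).det) (a b c : Fin 4) :
    ContDiffOn ℝ (⊤ : ℕ∞) (fun y => levi g y a b c) U := by
  unfold levi
  refine contDiffOn_const.mul (ContDiffOn.sum fun i _ => ?_)
  exact (inv_smooth g hg hginv a i).mul (((pd_smooth hU _ (hg _ _)).add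
    (pd_smooth hU _ (hg _ _))).sub (pd_smooth hU _ (hg _ _)))

theorem pd_log (k : Fin 4) (hf : DifferentiableAt ℝ f x) (hx : 0 < f x) :
    pd k f x = f x * pd k (fun z => Real.log (f z)) x := by
  unfold pd
  rw [fderiv.log hf hx.ne']
  simp [hx.ne']

theorem pd_inv (k : Fin 4) (hf : DifferentiableAt ℝ f x) (hx : 0 < f x) :
    pd k (fun y => (f y)⁻¹) x = - (f x)⁻¹ * pd k (fun z => Real.log (f z)) x := by
  unfold pd
  have h1 : HasFDerivAt (fun y => (f y)⁻¹) _ x :=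
    (hasDerivAt_inv hx.ne').comp_hasFDerivAt x hf.hasFDerivAt
  rw [fderiv.log hf hx.ne', h1.fderiv]
  simp
  ring

end helpers

theorem inv_conf (A : Matrix (Fin 4) (Fin 4) ℝ) (c : ℝ) (hc : c ≠ 0) (hA : IsUnit A.det)
    (i j : Fin 4) : (c • A)⁻¹ i j = c⁻¹ * A⁻¹ i j := by
  have : (c • A)⁻¹ = c⁻¹ • A⁻¹ := by
    apply Matrix.inv_eq_right_inv
    rw [Matrix.smul_mul, Matrix.mul_smul, Matrix.mul_nonsing_inv _ hA, smul_smul,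
      mul_inv_cancel₀ hc, one_smul]
  rw [this]; simp

/-- The conformal change of the Levi-Civita connection. -/
theorem levi_conf (g : (Fin 4 → ℝ) → Matrix (Fin 4) (Fin 4) ℝ) (x : Fin 4 → ℝ)
    (hg : ∀ μ ν : Fin 4, DifferentiableAt ℝ (fun x => g x μ ν) x)
    (hgsym : (g x)ᵀ = g x) (hginv : IsUnit (g x).det)
    (Ω : (Fin 4 → ℝ) → ℝ) (hΩ : DifferentiableAt ℝ Ω x) (hΩpos : 0 < Ω x) (a b c : Fin 4) :
    levi (fun y => (Ω y) ^ 2 • g y) x a b c = levi g x a b c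
      + ((if a = b then pd c (fun z => Real.log (Ω z)) x else 0)
        + (if a = c then pd b (fun z => Real.log (Ω z)) x else 0)
        - g x b c * ∑ ν, (g x)⁻¹ a ν * pd ν (fun z => Real.log (Ω z)) x) := by
  have hs : ∀ i j, g x i j = g x j i := fun i j => congrFun (congrFun hgsym j) i
  have hGg : ∀ k, ∑ j, (g x)⁻¹ a j * g x j k = if a = k then 1 else 0 := by
    intro k
    have := congrFun (congrFun (Matrix.nonsing_inv_mul _ hginv) a) k
    rwa [Matrix.mul_apply, Matrix.one_apply] at this
  have hp : ∀ k i j, pd k (fun y => ((Ω y) ^ 2 • g y) i j) x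
      = (Ω x) ^ 2 * (2 * pd k (fun z => Real.log (Ω z)) x * g x i j
        + pd k (fun y => g y i j) x) := by
    intro k i j
    simp only [Matrix.smul_apply, smul_eq_mul, sq]
    rw [pd_mul k (hΩ.fun_mul hΩ) (hg i j), pd_mul k hΩ hΩ, pd_log k hΩ hΩpos]
    ring
  unfold levi
  simp only [hp, inv_conf (g x) _ (pow_ne_zero 2 hΩpos.ne') hginv]
  generalize hw : (fun k => pd k (fun z => Real.log (Ω z)) x) = w
  have hw' : ∀ k, pd k (fun z => Real.log (Ω z)) x = w k := fun k => congrFun hw k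
  simp only [hw']
  have e1 : ∀ k t, (if a = k then t else 0) = ∑ j, (g x)⁻¹ a j * (g x j k * t) := by
    intro k t
    have : (if a = k then t else 0) = (if a = k then 1 else 0) * t := by simp
    rw [this, ← hGg, Finset.sum_mul]
    exact Finset.sum_congr rfl fun _ _ => by ring
  rw [e1, e1, Finset.mul_sum, Finset.mul_sum, Finset.mul_sum, ← Finset.sum_add_distrib,
    ← Finset.sum_sub_distrib, ← Finset.sum_add_distrib]
  refine Finset.sum_congr rfl fun j _ => ?_
  have := hΩpos.ne'
  rw [hs j b]
  field_simp
  ring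

theorem alg_conf (g G : Fin 4 → Fin 4 → ℝ) (Γ : Fin 4 → Fin 4 → Fin 4 → ℝ)
    (w W : Fin 4 → ℝ) (dC : Fin 4 → Fin 4 → Fin 4 → Fin 4 → ℝ) (dw dW : Fin 4 → Fin 4 → ℝ)
    (d : Fin 4 → Fin 4 → Fin 4 → ℝ)
    (hG : ∀ i j, G i j = G j i) (hg : ∀ i j, g i j = g j i)
    (hGg : ∀ i k, ∑ j, G i j * g j k = if i = k then 1 else 0)
    (hΓ : ∀ a b c, Γ a b c = Γ a c b)
    (hW : ∀ a, ∑ b, G a b * w b = W a) (hw : ∀ a, ∑ b, g a b * W b = w a)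
    (C : Fin 4 → Fin 4 → Fin 4 → ℝ)
    (hC : ∀ a b c, C a b c = (if a = b then w c else 0) + (if a = c then w b else 0)
      - g b c * W a)
    (hd : ∀ k i j, d k i j = ∑ a, g a j * Γ a i k + ∑ a, g i a * Γ a j k)
    (hdw : ∀ k i, dw k i = ∑ a, d k i a * W a + ∑ a, g i a * dW k a)
    (hdC : ∀ k a b c, dC k a b c = (if a = b then dw k c else 0) + (if a = c then dw k b else 0)
      - (d k b c * W a + g b c * dW k a)) :
    ∑ j, ∑ i, G j i * ∑ a, (dC a a j i - dC i a j a
      + ∑ r, ((Γ a r a + C a r a) * (Γ r j i + C r j i)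
        - (Γ a r i + C a r i) * (Γ r j a + C r j a)))
    = ∑ j, ∑ i, G j i * ∑ a, ∑ r, (Γ a r a * Γ r j i - Γ a r i * Γ r j a)
      - 6 * (∑ a, dW a a + ∑ a, (∑ r, Γ r r a) * W a) - 6 * ∑ a, w a * W a := by
  have hw' : ∀ a, ∑ b, g b a * W b = w a := fun a => by
    rw [← hw a]; exact Finset.sum_congr rfl fun b _ => by rw [hg]
  have hW' : ∀ a, ∑ b, G b a * w b = W a := fun a => by
    rw [← hW a]; exact Finset.sum_congr rfl fun b _ => by rw [hG]
  have e1 : ∀ j i, ∑ a, dC a a j i = dw j i + dw i j - ∑ a, d a j i * W a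
      - g j i * ∑ a, dW a a := by
    intro j i
    simp [hdC, Finset.sum_sub_distrib, Finset.sum_add_distrib, Finset.mul_sum]
    ring
  have e2 : ∀ j i, ∑ a, dC i a j a = 4 * dw i j := by
    intro j i
    simp only [hdC, Finset.sum_sub_distrib, Finset.sum_add_distrib]
    rw [← hdw]
    simp
  have c1 : ∀ r, ∑ a, C a r a = 4 * w r := by
    intro r
    simp [hC, Finset.sum_sub_distrib, Finset.sum_add_distrib, hw]
  have c2 : ∀ (t : Fin 4 → ℝ) j i, ∑ r, t r * C r j i
      = t j * w i + t i * w j - g j i * ∑ r, t r * W r := by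
    intro t j i
    simp [hC, mul_sub, mul_add, Finset.sum_sub_distrib, Finset.sum_add_distrib, Finset.mul_sum]
    exact Finset.sum_congr rfl fun _ _ => by ring
  have q1 : ∀ j i, ∑ a, ∑ r, C a r i * Γ r j a
      = w i * ∑ r, Γ r r j + ∑ r, w r * Γ r j i - ∑ r, g r i * ∑ a, Γ r j a * W a := by
    intro j i
    simp [hC, sub_mul, add_mul, Finset.sum_sub_distrib, Finset.sum_add_distrib, Finset.mul_sum]
    rw [Finset.sum_comm (f := fun a r => g r i * W a * Γ r j a)]
    congr 1
    · congr 1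
      exact Finset.sum_congr rfl fun _ _ => by rw [hΓ]
    · exact Finset.sum_congr rfl fun _ _ => Finset.sum_congr rfl fun _ _ => by ring
  have q2 : ∀ j i, ∑ a, ∑ r, Γ a r i * C r j a
      = w j * ∑ r, Γ r r i + ∑ r, w r * Γ r j i - ∑ r, g r j * ∑ a, Γ r i a * W a := by
    intro j i
    simp [hC, mul_sub, mul_add, Finset.sum_sub_distrib, Finset.sum_add_distrib, Finset.mul_sum]
    rw [add_comm]
    congr 1
    · congr 1
      · exact Finset.sum_congr rfl fun _ _ => by ring
      · exact Finset.sum_congr rfl fun _ _ => by ring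
    · exact Finset.sum_congr rfl fun a _ => Finset.sum_congr rfl fun r _ => by
        rw [hg j a, hΓ a r i]; ring
  have q3 : ∀ j i, ∑ a, ∑ r, C a r i * C r j a
      = 6 * (w i * w j) - 2 * (g j i * ∑ a, w a * W a) := by
    intro j i
    have h1 : ∀ a, ∑ r, C a r i * C r j a = C a j i * w a + C a a i * w j
        - g j a * ∑ r, C a r i * W r := fun a => c2 (fun r => C a r i) j a
    have h2 : ∀ a, ∑ r, C a r i * W r = W a * w i + (if a = i then ∑ r, w r * W r else 0)
        - w i * W a := by
      intro a
      have : ∑ r, g r i * W a * W r = w i * W a := by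
        rw [← hw' i, Finset.sum_mul]
        exact Finset.sum_congr rfl fun _ _ => by ring
      simp only [hC, sub_mul, add_mul, Finset.sum_sub_distrib, Finset.sum_add_distrib, this]
      by_cases h : a = i <;> simp [h] <;> ring
    simp only [h1, h2, Finset.sum_sub_distrib, Finset.sum_add_distrib]
    have h3 : ∑ a, C a j i * w a = 2 * (w j * w i) - g j i * ∑ r, w r * W r := by
      have := c2 w j i
      simp only [mul_comm (w _) (C _ _ _)] at this
      rw [this]; ring
    have h4 : ∑ a, C a a i = 4 * w i := by
      simp [hC, Finset.sum_sub_distrib, Finset.sum_add_distrib, hw']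
    have h5 : ∑ a, g j a * (W a * w i + (if a = i then ∑ r, w r * W r else 0)
        - w i * W a) = g j i * ∑ r, w r * W r := by
      have : ∀ a, g j a * (W a * w i + (if a = i then ∑ r, w r * W r else 0)
        - w i * W a) = if a = i then g j a * ∑ r, w r * W r else 0 := by
        intro a; split_ifs <;> ring
      simp [this]
    rw [h3, h5, ← Finset.sum_mul, h4]
    ring
  have tr : ∀ i, ∑ a, Γ a i a = ∑ r, Γ r r i := fun i =>
    Finset.sum_congr rfl fun _ _ => hΓ _ _ _
  -- the Ricci difference
  have ric : ∀ j i, ∑ a, (dC a a j i - dC i a j a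
      + ∑ r, ((Γ a r a + C a r a) * (Γ r j i + C r j i)
        - (Γ a r i + C a r i) * (Γ r j a + C r j a)))
      = ∑ a, ∑ r, (Γ a r a * Γ r j i - Γ a r i * Γ r j a)
       + (dw j i - 3 * dw i j - ∑ a, d a j i * W a + 2 * (w i * w j)
        + 2 * ∑ r, w r * Γ r j i + ∑ r, g r i * ∑ a, Γ r j a * W a 
        + ∑ r, g r j * ∑ a, Γ r i a * W a
        - g j i * (∑ a, dW a a + (∑ a, (∑ r, Γ r r a) * W a) + 2 * ∑ a, w a * W a)) := by
    intro j i
    have s1 : ∑ a, ∑ r, Γ a r a * C r j i = (∑ r, Γ r r j) * w i + (∑ r, Γ r r i) * w j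
        - g j i * ∑ a, (∑ r, Γ r r a) * W a := by
      rw [Finset.sum_comm]
      simp only [← Finset.sum_mul, tr]
      exact c2 (fun k => ∑ r, Γ r r k) j i
    have s2 : ∑ a, ∑ r, C a r a * Γ r j i = 4 * ∑ r, w r * Γ r j i := by
      rw [Finset.sum_comm]
      simp only [← Finset.sum_mul, c1, mul_assoc, ← Finset.mul_sum]
    have s3 : ∑ a, ∑ r, C a r a * C r j i = 8 * (w i * w j)
        - 4 * (g j i * ∑ a, w a * W a) := by
      rw [Finset.sum_comm]
      simp only [← Finset.sum_mul, c1, mul_assoc, ← Finset.mul_sum, c2]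
      ring
    simp only [add_mul, mul_add, Finset.sum_sub_distrib, Finset.sum_add_distrib, e1, e2, s1, s2,
      s3, q1, q2, q3]
    ring
  have Gg1 : ∀ t : Fin 4 → Fin 4 → ℝ, ∑ j, ∑ i, G j i * ∑ r, g r i * t r j = ∑ r, t r r := by
    intro t
    have : ∀ j, ∑ i, G j i * ∑ r, g r i * t r j = t j j := by
      intro j
      simp only [Finset.mul_sum]
      rw [Finset.sum_comm]
      have : ∀ r, ∑ i, G j i * (g r i * t r j) = (if j = r then 1 else 0) * t r j := by
        intro r
        rw [← hGg, Finset.sum_mul]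
        exact Finset.sum_congr rfl fun _ _ => by rw [hg]; ring
      simp [this]
    simp [this]
  have Gswap : ∀ t : Fin 4 → Fin 4 → ℝ, ∑ j, ∑ i, G j i * t i j = ∑ j, ∑ i, G j i * t j i := by
    intro t
    rw [Finset.sum_comm]
    exact Finset.sum_congr rfl fun _ _ => Finset.sum_congr rfl fun _ _ => by rw [hG]
  have Gg2 : ∀ t : Fin 4 → Fin 4 → ℝ, ∑ j, ∑ i, G j i * ∑ r, g r j * t r i = ∑ r, t r r := by
    intro t
    rw [← Gg1 t, Gswap (fun i j => ∑ r, g r i * t r j)]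
  have G4 : ∑ j, ∑ i, G j i * g j i = 4 := by
    have : ∀ j, ∑ i, G j i * g j i = 1 := fun j => by
      have := hGg j j
      rw [if_pos rfl] at this
      rw [← this]
      exact Finset.sum_congr rfl fun _ _ => by rw [hg]
    simp [this]
  have Gww : ∑ j, ∑ i, G j i * (w i * w j) = ∑ a, w a * W a := by
    refine Finset.sum_congr rfl fun j _ => ?_
    rw [← hW j, Finset.mul_sum]
    exact Finset.sum_congr rfl fun _ _ => by ring
  have G1 : ∑ j, ∑ i, G j i * ∑ r, g r i * ∑ a, Γ r j a * W a
      = ∑ a, (∑ r, Γ r r a) * W a := by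
    rw [Gg1 (fun r j => ∑ a, Γ r j a * W a), Finset.sum_comm]
    simp only [Finset.sum_mul]
  have G2 : ∑ j, ∑ i, G j i * ∑ r, g r j * ∑ a, Γ r i a * W a
      = ∑ a, (∑ r, Γ r r a) * W a := by
    rw [Gg2 (fun r j => ∑ a, Γ r j a * W a), Finset.sum_comm]
    simp only [Finset.sum_mul]
  have G3 : ∑ j, ∑ i, G j i * ∑ a, d a j i * W a = 2 * ∑ a, (∑ r, Γ r r a) * W a := by
    have : ∀ j i, ∑ a, d a j i * W a = ∑ r, g r i * ∑ a, Γ r j a * W a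
        + ∑ r, g r j * ∑ a, Γ r i a * W a := by
      intro j i
      simp only [hd, add_mul, Finset.sum_add_distrib, Finset.sum_mul, Finset.mul_sum]
      rw [Finset.sum_comm, Finset.sum_comm (f := fun a r => g j r * Γ r i a * W a)]
      congr 1
      · exact Finset.sum_congr rfl fun _ _ => Finset.sum_congr rfl fun _ _ => by ring
      · exact Finset.sum_congr rfl fun r _ => Finset.sum_congr rfl fun _ _ => by
          rw [hg j r]; ring
    simp only [this, mul_add, Finset.sum_add_distrib, G1, G2]
    ring
  have G5 : ∑ j, ∑ i, G j i * dw i j = ∑ a, dW a a + ∑ j, ∑ i, G j i * ∑ r, w r * Γ r j i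
      + ∑ a, (∑ r, Γ r r a) * W a := by
    have : ∀ j i, dw i j = ∑ r, w r * Γ r j i + ∑ r, g r j * ∑ a, Γ r i a * W a
        + ∑ a, g a j * dW i a := by
      intro j i
      rw [hdw]
      simp only [hd, add_mul, Finset.sum_add_distrib, Finset.sum_mul, Finset.mul_sum]
      congr 1
      · congr 1
        · rw [Finset.sum_comm]
          refine Finset.sum_congr rfl fun r _ => ?_
          rw [← hw, Finset.sum_mul]
          exact Finset.sum_congr rfl fun _ _ => by ring
        · rw [Finset.sum_comm]
          refine Finset.sum_congr rfl fun r _ => Finset.sum_congr rfl fun a _ => ?_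
          rw [hg j r, hΓ r a i]; ring
      · exact Finset.sum_congr rfl fun r _ => by rw [hg j r]
    simp only [this, mul_add, Finset.sum_add_distrib, G2]
    rw [Gg2 (fun a i => dW i a)]
    ring
  have G6 : ∑ j, ∑ i, G j i * dw j i = ∑ j, ∑ i, G j i * dw i j := by
    rw [Gswap]
  have lin : ∀ (c : ℝ) (t : Fin 4 → Fin 4 → ℝ), ∑ j, ∑ i, G j i * (c * t j i)
      = c * ∑ j, ∑ i, G j i * t j i := by
    intro c t
    simp only [Finset.mul_sum]
    exact Finset.sum_congr rfl fun _ _ => Finset.sum_congr rfl fun _ _ => by ring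
  have lin' : ∀ (c : ℝ) , ∑ j, ∑ i, G j i * (g j i * c) = 4 * c := by
    intro c
    rw [← G4]
    simp only [Finset.sum_mul]
    exact Finset.sum_congr rfl fun _ _ => Finset.sum_congr rfl fun _ _ => by ring
  simp only [ric]
  simp only [mul_add (G _ _), mul_sub (G _ _), Finset.sum_add_distrib, Finset.sum_sub_distrib,
    lin, lin', G1, G2, G3, G5, G6, Gww]
  ring

theorem levi_lower (g : (Fin 4 → ℝ) → Matrix (Fin 4) (Fin 4) ℝ) (x : Fin 4 → ℝ)
    (hginv : IsUnit (g x).det) (i j k : Fin 4) :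
    ∑ a, g x j a * levi g x a i k = (1 / 2) * (pd k (fun y => g y i j) x
      + pd i (fun y => g y j k) x - pd j (fun y => g y i k) x) := by
  have hgG : ∀ k, ∑ a, g x j a * (g x)⁻¹ a k = if j = k then 1 else 0 := by
    intro k
    have := congrFun (congrFun (Matrix.mul_nonsing_inv _ hginv) j) k
    rwa [Matrix.mul_apply, Matrix.one_apply] at this
  unfold levi
  simp only [Finset.mul_sum]
  rw [Finset.sum_comm]
  have : ∀ m, ∑ a, g x j a * (1 / 2 * ((g x)⁻¹ a m * (pd k (fun y => g y i m) x
      + pd i (fun y => g y m k) x - pd m (fun y => g y i k) x)))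
      = (if j = m then 1 else 0) * (1 / 2 * (pd k (fun y => g y i m) x
      + pd i (fun y => g y m k) x - pd m (fun y => g y i k) x)) := by
    intro m
    rw [← hgG, Finset.sum_mul]
    exact Finset.sum_congr rfl fun _ _ => by ring
  simp only [this]
  simp

/-- The conformal change of the scalar curvature. -/
theorem scal_conf
    (U : Set (Fin 4 → ℝ)) (hU : IsOpen U)
    (g : (Fin 4 → ℝ) → Matrix (Fin 4) (Fin 4) ℝ)
    (hg : ∀ μ ν : Fin 4, ContDiffOn ℝ (⊤ : ℕ∞) (fun x => g x μ ν) U)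
    (hgsym : ∀ x ∈ U, (g x)ᵀ = g x)
    (hginv : ∀ x ∈ U, IsUnit (g x).det)
    (Ω : (Fin 4 → ℝ) → ℝ) (hΩ : ContDiffOn ℝ (⊤ : ℕ∞) Ω U)
    (hΩpos : ∀ x ∈ U, 0 < Ω x) (w W : Fin 4 → (Fin 4 → ℝ) → ℝ)
    (hw : ∀ k y, w k y = pd k (fun z => Real.log (Ω z)) y)
    (hW : ∀ k y, W k y = ∑ ν, (g y)⁻¹ k ν * w ν y)
    (hws : ∀ k, ContDiffOn ℝ (⊤ : ℕ∞) (w k) U) (hWs : ∀ k, ContDiffOn ℝ (⊤ : ℕ∞) (W k) U)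
    (x : Fin 4 → ℝ) (hx : x ∈ U) :
    scal (fun y => (Ω y) ^ 2 • g y) x = ((Ω x) ^ 2)⁻¹ * (scal g x
      - 6 * (∑ a, pd a (W a) x + ∑ a, (∑ r, levi g x r r a) * W a x)
      - 6 * ∑ a, w a x * W a x) := by
  have hs : ∀ y ∈ U, ∀ i j, g y i j = g y j i :=
    fun y hy i j => congrFun (congrFun (hgsym y hy) j) i
  have hds : ∀ k i j, pd k (fun y => g y i j) x = pd k (fun y => g y j i) x :=
    fun k i j => pd_congr_open hU hx k fun y hy => hs y hy i j
  have hGs : ∀ i j, (g x)⁻¹ i j = (g x)⁻¹ j i := by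
    intro i j
    have h : ((g x)⁻¹)ᵀ = (g x)⁻¹ := by rw [Matrix.transpose_nonsing_inv, hgsym x hx]
    exact congrFun (congrFun h j) i
  have hgW : ∀ y ∈ U, ∀ a, ∑ b, g y a b * W b y = w a y := by
    intro y hy a
    have h : g y *ᵥ ((g y)⁻¹ *ᵥ fun ν => w ν y) = fun ν => w ν y := by
      rw [Matrix.mulVec_mulVec, Matrix.mul_nonsing_inv _ (hginv y hy), Matrix.one_mulVec]
    simpa [Matrix.mulVec, dotProduct, hW] using congrFun h a
  have dg : ∀ i j, DifferentiableAt ℝ (fun y => g y i j) x := fun i j => smooth_diff hU hx (hg i j)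
  have dwd : ∀ i, DifferentiableAt ℝ (w i) x := fun i => smooth_diff hU hx (hws i)
  have dWd : ∀ i, DifferentiableAt ℝ (W i) x := fun i => smooth_diff hU hx (hWs i)
  have dl : ∀ a b c, DifferentiableAt ℝ (fun y => levi g y a b c) x :=
    fun a b c => smooth_diff hU hx (levi_smooth hU g hg hginv a b c)
  let C : Fin 4 → Fin 4 → Fin 4 → (Fin 4 → ℝ) → ℝ := fun a b c y =>
    (if a = b then w c y else 0) + (if a = c then w b y else 0) - g y b c * W a y
  have hlevi : ∀ y ∈ U, ∀ a b c, levi (fun y => (Ω y) ^ 2 • g y) y a b c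
      = levi g y a b c + C a b c y := by
    intro y hy a b c
    rw [levi_conf g y (fun i j => smooth_diff hU hy (hg i j)) (hgsym y hy) (hginv y hy) Ω
      (smooth_diff hU hy hΩ) (hΩpos y hy)]
    simp only [C, hW, hw]
  have dite : ∀ (p : Prop) [Decidable p] i,
      DifferentiableAt ℝ (fun y => if p then w i y else 0) x := by
    intro p _ i
    split_ifs
    · exact dwd i
    · exact differentiableAt_const _
  have dC : ∀ a b c, DifferentiableAt ℝ (C a b c) x := fun a b c =>
    ((dite _ _).fun_add (dite _ _)).fun_sub ((dg b c).fun_mul (dWd a))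
  have pC : ∀ k a b c, pd k (C a b c) x = (if a = b then pd k (w c) x else 0)
      + (if a = c then pd k (w b) x else 0)
      - (pd k (fun y => g y b c) x * W a x + g x b c * pd k (W a) x) := by
    intro k a b c
    simp only [C]
    rw [pd_sub k ((dite _ _).fun_add (dite _ _)) ((dg b c).fun_mul (dWd a)),
      pd_add k (dite _ _) (dite _ _), pd_ite, pd_ite, pd_mul k (dg b c) (dWd a)]
  have plevi : ∀ k a b c, pd k (fun y => levi (fun y => (Ω y) ^ 2 • g y) y a b c) x
      = pd k (fun y => levi g y a b c) x + pd k (C a b c) x := by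
    intro k a b c
    rw [pd_congr_open hU hx k fun y hy => hlevi y hy a b c]
    exact pd_add k (dl a b c) (dC a b c)
  have alg := alg_conf (fun i j => g x i j) (fun i j => (g x)⁻¹ i j) (levi g x)
    (fun k => w k x) (fun k => W k x) (fun k a b c => pd k (C a b c) x)
    (fun k i => pd k (w i) x) (fun k i => pd k (W i) x) (fun k i j => pd k (fun y => g y i j) x)
    hGs (hs x hx)
    (fun i k => by
      have := congrFun (congrFun (Matrix.nonsing_inv_mul _ (hginv x hx)) i) k
      rwa [Matrix.mul_apply, Matrix.one_apply] at this)
    (fun a b c => by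
      unfold levi
      congr 1
      refine Finset.sum_congr rfl fun m _ => ?_
      rw [hds c b m, hds b m c, hds m b c]
      ring)
    (fun a => (hW a x).symm) (hgW x hx) (fun a b c => C a b c x) (fun a b c => rfl)
    (fun k i j => by
      have e : ∑ a, g x a j * levi g x a i k = ∑ a, g x j a * levi g x a i k :=
        Finset.sum_congr rfl fun a _ => by rw [hs x hx]
      rw [e, levi_lower g x (hginv x hx), levi_lower g x (hginv x hx), hds k j i, hds i j k,
        hds j i k]
      ring)
    (fun k i => by
      rw [pd_congr_open hU hx k fun y hy => (hgW y hy i).symm,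
        pd_sum k _ fun a => (dg i a).fun_mul (dWd a), ← Finset.sum_add_distrib]
      exact Finset.sum_congr rfl fun a _ => pd_mul k (dg i a) (dWd a))
    pC
  have e1 : scal (fun y => (Ω y) ^ 2 • g y) x = ((Ω x) ^ 2)⁻¹ * ∑ j, ∑ i, (g x)⁻¹ j i *
      ∑ a, riem (fun y => (Ω y) ^ 2 • g y) x a j a i := by
    unfold scal ricci
    simp only [inv_conf (g x) _ (pow_ne_zero 2 (hΩpos x hx).ne') (hginv x hx), mul_assoc,
      ← Finset.mul_sum]
  rw [e1]
  congr 1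
  simp only [riem, plevi, hlevi x hx]
  have e2 : ∀ j i, ∑ a, (pd a (fun y => levi g y a j i) x + pd a (C a j i) x
      - (pd i (fun y => levi g y a j a) x + pd i (C a j a) x)
      + ∑ r, ((levi g x a r a + C a r a x) * (levi g x r j i + C r j i x)
        - (levi g x a r i + C a r i x) * (levi g x r j a + C r j a x)))
     = ∑ a, (pd a (fun y => levi g y a j i) x - pd i (fun y => levi g y a j a) x)
      + ∑ a, (pd a (C a j i) x - pd i (C a j a) x
      + ∑ r, ((levi g x a r a + C a r a x) * (levi g x r j i + C r j i x)
        - (levi g x a r i + C a r i x) * (levi g x r j a + C r j a x))) := by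
    intro j i
    rw [← Finset.sum_add_distrib]
    exact Finset.sum_congr rfl fun a _ => by ring
  simp only [e2]
  simp only [mul_add ((g x)⁻¹ _ _), Finset.sum_add_distrib (f := fun _ => _ * _)]
  simp only [scal, ricci, riem]
  simp only [Finset.sum_add_distrib, mul_add ((g x)⁻¹ _ _)] at alg ⊢
  rw [alg]
  ring

/-- conformal invariance of the conformally coupled scalar Lagrangian:
with `g'_{αβ} = Ω² g_{αβ}` and `φ' = Ω⁻¹ φ`, the Lagrangian densities differ by a total
divergence:
`√|det g'|(g'^{αβ}∂φ'∂φ' + (R'/6)φ'²) = √|det g|(g^{αβ}∂φ∂φ + (R/6)φ²) −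
∂_μ(√|det g| g^{μν} φ² ∂_ν ln Ω)`. -/
theorem conformal_scalar_lagrangian_invariant_up_to_divergence
    (U : Set (Fin 4 → ℝ)) (hU : IsOpen U)
    (g : (Fin 4 → ℝ) → Matrix (Fin 4) (Fin 4) ℝ)
    (hg : ∀ μ ν : Fin 4, ContDiffOn ℝ (⊤ : ℕ∞) (fun x => g x μ ν) U)
    (hgsym : ∀ x ∈ U, (g x)ᵀ = g x)
    (hginv : ∀ x ∈ U, IsUnit (g x).det)
    (φ : (Fin 4 → ℝ) → ℝ) (hφ : ContDiffOn ℝ (⊤ : ℕ∞) φ U)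
    (Ω : (Fin 4 → ℝ) → ℝ) (hΩ : ContDiffOn ℝ (⊤ : ℕ∞) Ω U)
    (hΩpos : ∀ x ∈ U, 0 < Ω x) :
    ∀ x ∈ U,
      scalarLagrangian (fun y => (Ω y) ^ 2 • g y) (fun y => (Ω y)⁻¹ * φ y) x
        = scalarLagrangian g φ x
          - ∑ μ, pd μ (fun y => Real.sqrt |(g y).det| *
              ∑ ν, (g y)⁻¹ μ ν * (φ y) ^ 2 * pd ν (fun z => Real.log (Ω z)) y) x := by
  intro x hx
  obtain ⟨w, hw⟩ : ∃ w : Fin 4 → (Fin 4 → ℝ) → ℝ,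
      ∀ k y, w k y = pd k (fun z => Real.log (Ω z)) y := ⟨_, fun _ _ => rfl⟩
  obtain ⟨W, hW⟩ : ∃ W : Fin 4 → (Fin 4 → ℝ) → ℝ,
      ∀ k y, W k y = ∑ ν, (g y)⁻¹ k ν * w ν y := ⟨_, fun _ _ => rfl⟩
  have hws : ∀ k, ContDiffOn ℝ (⊤ : ℕ∞) (w k) U := by
    intro k
    rw [show w k = pd k (fun z => Real.log (Ω z)) from funext (hw k)]
    exact pd_smooth hU k (hΩ.log fun y hy => (hΩpos y hy).ne')
  have hWs : ∀ k, ContDiffOn ℝ (⊤ : ℕ∞) (W k) U := by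
    intro k
    rw [show W k = fun y => ∑ ν, (g y)⁻¹ k ν * w ν y from funext (hW k)]
    exact ContDiffOn.sum fun i _ => (inv_smooth g hg hginv k i).mul (hws i)
  have hsc := scal_conf U hU g hg hgsym hginv Ω hΩ hΩpos w W hw hW hws hWs x hx
  have dg : ∀ i j, DifferentiableAt ℝ (fun y => g y i j) x := fun i j => smooth_diff hU hx (hg i j)
  have dW : ∀ i, DifferentiableAt ℝ (W i) x := fun i => smooth_diff hU hx (hWs i)
  have dφ : DifferentiableAt ℝ φ x := smooth_diff hU hx hφ
  have dΩ : DifferentiableAt ℝ Ω x := smooth_diff hU hx hΩ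
  have hpos := hΩpos x hx
  have hGs : ∀ i j, (g x)⁻¹ i j = (g x)⁻¹ j i := by
    intro i j
    have h : ((g x)⁻¹)ᵀ = (g x)⁻¹ := by rw [Matrix.transpose_nonsing_inv, hgsym x hx]
    exact congrFun (congrFun h j) i
  have hds : ∀ k i j, pd k (fun y => g y i j) x = pd k (fun y => g y j i) x :=
    fun k i j => pd_congr_open hU hx k fun y hy => congrFun (congrFun (hgsym y hy) j) i
  -- trace of the connection
  have htr : ∀ μ, (1 / 2) * ∑ i, ∑ j, pd μ (fun y => g y i j) x * (g x)⁻¹ j i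
      = ∑ r, levi g x r r μ := by
    intro μ
    unfold levi
    rw [← Finset.mul_sum]
    congr 1
    have hsw : ∑ r, ∑ m, (g x)⁻¹ r m * pd r (fun y => g y m μ) x
        = ∑ r, ∑ m, (g x)⁻¹ r m * pd m (fun y => g y r μ) x := by
      rw [Finset.sum_comm]
      exact Finset.sum_congr rfl fun _ _ => Finset.sum_congr rfl fun _ _ => by rw [hGs]
    simp only [mul_sub, mul_add, Finset.sum_sub_distrib, Finset.sum_add_distrib, hsw,
      add_sub_cancel_right]
    exact Finset.sum_congr rfl fun i _ => Finset.sum_congr rfl fun j _ => by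
      rw [hGs j i]; ring
  -- the divergence term
  have hdiv : ∀ μ, pd μ (fun y => Real.sqrt |(g y).det| *
      ∑ ν, (g y)⁻¹ μ ν * (φ y) ^ 2 * pd ν (fun z => Real.log (Ω z)) y) x
      = Real.sqrt |(g x).det| * ((φ x) ^ 2 * (pd μ (W μ) x + (∑ r, levi g x r r μ) * W μ x)
        + 2 * φ x * (pd μ φ x * W μ x)) := by
    intro μ
    have e : (fun y => Real.sqrt |(g y).det| *
      ∑ ν, (g y)⁻¹ μ ν * (φ y) ^ 2 * pd ν (fun z => Real.log (Ω z)) y)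
      = fun y => Real.sqrt |(g y).det| * (φ y * φ y * W μ y) := by
      funext y
      congr 1
      rw [hW, Finset.mul_sum]
      exact Finset.sum_congr rfl fun _ _ => by rw [hw]; ring
    obtain ⟨d1, d2⟩ := pd_sqrt_det g x dg (hginv x hx) μ
    rw [e, pd_mul μ d1 ((dφ.fun_mul dφ).fun_mul (dW μ)), pd_mul μ (dφ.fun_mul dφ) (dW μ),
      pd_mul μ dφ dφ, d2, htr]
    ring
  simp only [hdiv]
  have hφ' : ∀ α, pd α (fun y => (Ω y)⁻¹ * φ y) x = (Ω x)⁻¹ * (pd α φ x - φ x * w α x) := by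
    intro α
    rw [pd_mul α (dΩ.fun_inv hpos.ne') dφ, pd_inv α dΩ hpos, hw]
    ring
  have hdet : Real.sqrt |((Ω x) ^ 2 • g x).det| = (Ω x) ^ 4 * Real.sqrt |(g x).det| := by
    rw [Matrix.det_smul, abs_mul, Real.sqrt_mul (abs_nonneg _)]
    congr 1
    rw [Fintype.card_fin, ← pow_mul, abs_of_nonneg (by positivity),
      show (Ω x) ^ (2 * 4) = ((Ω x) ^ 4) ^ 2 by ring, Real.sqrt_sq (by positivity)]
  have hkin : ∑ α, ∑ β, (g x)⁻¹ α β * (pd α φ x - φ x * w α x) * (pd β φ x - φ x * w β x)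
      = ∑ α, ∑ β, (g x)⁻¹ α β * pd α φ x * pd β φ x - 2 * φ x * ∑ μ, pd μ φ x * W μ x
        + (φ x) ^ 2 * ∑ μ, w μ x * W μ x := by
    have a1 : ∑ μ, pd μ φ x * W μ x = ∑ α, ∑ β, (g x)⁻¹ α β * pd α φ x * w β x := by
      simp only [hW, Finset.mul_sum]
      exact Finset.sum_congr rfl fun _ _ => Finset.sum_congr rfl fun _ _ => by ring
    have a2 : ∑ μ, pd μ φ x * W μ x = ∑ α, ∑ β, (g x)⁻¹ α β * w α x * pd β φ x := by
      rw [a1, Finset.sum_comm]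
      exact Finset.sum_congr rfl fun α _ => Finset.sum_congr rfl fun β _ => by
        rw [hGs]; ring
    have a3 : ∑ μ, w μ x * W μ x = ∑ α, ∑ β, (g x)⁻¹ α β * w α x * w β x := by
      simp only [hW, Finset.mul_sum]
      exact Finset.sum_congr rfl fun _ _ => Finset.sum_congr rfl fun _ _ => by ring
    rw [show 2 * φ x * ∑ μ, pd μ φ x * W μ x = φ x * ∑ μ, pd μ φ x * W μ x
      + φ x * ∑ μ, pd μ φ x * W μ x by ring]
    nth_rewrite 1 [a1]
    rw [a2, a3]
    simp only [Finset.mul_sum, ← Finset.sum_add_distrib, ← Finset.sum_sub_distrib]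
    exact Finset.sum_congr rfl fun _ _ => Finset.sum_congr rfl fun _ _ => by ring
  have hkin' : ∑ α, ∑ β, ((Ω x) ^ 2 • g x)⁻¹ α β * pd α (fun y => (Ω y)⁻¹ * φ y) x
      * pd β (fun y => (Ω y)⁻¹ * φ y) x
      = ((Ω x) ^ 4)⁻¹ * (∑ α, ∑ β, (g x)⁻¹ α β * pd α φ x * pd β φ x
        - 2 * φ x * ∑ μ, pd μ φ x * W μ x + (φ x) ^ 2 * ∑ μ, w μ x * W μ x) := by
    rw [← hkin]
    simp only [Finset.mul_sum, hφ', inv_conf (g x) _ (pow_ne_zero 2 hpos.ne') (hginv x hx)]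
    exact Finset.sum_congr rfl fun _ _ => Finset.sum_congr rfl fun _ _ => by
      field_simp
  unfold scalarLagrangian
  rw [hsc, hdet, hkin']
  rw [← Finset.mul_sum, Finset.sum_add_distrib, ← Finset.mul_sum, ← Finset.mul_sum,
    Finset.sum_add_distrib]
  field_simp
  ring
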